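/- arXiv:0712.3902 — 2 statements merged into one kernel-verified Lean document; each statement's English description precedes it below -/
import Mathlib

section
/- Let 0 < q < 1, let a ∈ ℝ, and let s, t ∈ ℝ with s > -1, |t| < 1 and |a t| < 1. Then all series below converge absolutely and the Al-Salam–Carlitz addition identity holds: ((-s;q)_∞ / (t;q)_∞) · Σ_{n=0}^∞ a^n · ∏_{i=0}^{n-1}(t + s q^i) / ((q;q)_n (-s;q)_n) = (1/((t;q)_∞ (a t;q)_∞)) · Σ_{n=0}^∞ ((-s q^n;q)_∞/(q;q)_n) · (-a s t)^n q^{n(n-1)} · ₁φ₁(0; -s q^n; q, -a s q^n). -/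
/-- The q-shifted factorial `(a;q)_n = ∏_{i=0}^{n-1} (1 - a q^i)`. -/
noncomputable def qpoch (a q : ℝ) (n : ℕ) : ℝ := ∏ i ∈ Finset.range n, (1 - a * q ^ i)

/-- The infinite q-shifted factorial `(a;q)_∞ = ∏_{i=0}^∞ (1 - a q^i)`. -/
noncomputable def qpochInf (a q : ℝ) : ℝ := ∏' i : ℕ, (1 - a * q ^ i)

/-- The basic hypergeometric series `₁φ₁(A; C; q, z)`. -/
noncomputable def qphi11 (A C q z : ℝ) : ℝ :=
  ∑' n : ℕ, qpoch A q n * (-1) ^ n * q ^ (n * (n - 1) / 2) * z ^ n /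
    (qpoch q q n * qpoch C q n)


open Filter Topology

lemma ratio_summable (f r : ℕ → ℝ) (L : ℝ) (hL : |L| < 1) (hr : Tendsto r atTop (𝓝 L))
    (h : ∀ n, f (n + 1) = r n * f n) : Summable f := by
  obtain ⟨c, hc1, hc2⟩ := exists_between hL
  refine summable_of_ratio_norm_eventually_le (r := c) hc2 ?_
  have := hr.abs.eventually (gt_mem_nhds hc1)
  filter_upwards [this] with n hn
  rw [h, norm_mul]
  exact mul_le_mul_of_nonneg_right (le_of_lt hn) (norm_nonneg _)

section
variable {q : ℝ}

lemma qp_succ (x : ℝ) (n : ℕ) : qpoch x q (n + 1) = qpoch x q n * (1 - x * q ^ n) := by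
  simp [qpoch, Finset.prod_range_succ]

lemma qp_zero (x : ℝ) : qpoch x q 0 = 1 := by simp [qpoch]

lemma qp_pos (hq0 : 0 < q) (hq1 : q < 1) (x : ℝ) (hx : x < 1) (n : ℕ) : 0 < qpoch x q n := by
  unfold qpoch
  refine Finset.prod_pos fun i _ => ?_
  have h1 : q ^ i ≤ 1 := pow_le_one₀ hq0.le hq1.le
  have h2 : 0 < q ^ i := pow_pos hq0 i
  nlinarith

lemma qtend (hq0 : 0 < q) (hq1 : q < 1) : Tendsto (fun n : ℕ => q ^ n) atTop (𝓝 0) :=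
  tendsto_pow_atTop_nhds_zero_of_lt_one hq0.le hq1

lemma qmult (hq0 : 0 < q) (hq1 : q < 1) (x : ℝ) : Multipliable (fun i : ℕ => 1 - x * q ^ i) := by
  have := Real.multipliable_one_add_of_summable (f := fun i : ℕ => -x * q ^ i)
    ((summable_geometric_of_lt_one hq0.le hq1).mul_left (-x))
  refine this.congr fun i => by ring

lemma qinf_split (hq0 : 0 < q) (hq1 : q < 1) (x : ℝ) (k : ℕ) :
    qpochInf x q = qpoch x q k * qpochInf (x * q ^ k) q := by
  have h1 := (qmult hq0 hq1 x).hasProd.tendsto_prod_nat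
  have h2 := (qmult hq0 hq1 (x * q ^ k)).hasProd.tendsto_prod_nat
  have h3 := h2.const_mul (qpoch x q k)
  have h4 := h1.comp (tendsto_add_atTop_nat k)
  refine tendsto_nhds_unique h4 (h3.congr fun n => ?_)
  simp only [Function.comp, qpoch]
  rw [add_comm n k, Finset.prod_range_add]
  congr 1
  exact Finset.prod_congr rfl fun i _ => by ring

lemma qinf_tendsto (hq0 : 0 < q) (hq1 : q < 1) (x : ℝ) :
    Tendsto (fun n => qpoch x q n) atTop (𝓝 (qpochInf x q)) :=
  (qmult hq0 hq1 x).hasProd.tendsto_prod_nat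

lemma qinf_bound (hq0 : 0 < q) (hq1 : q < 1) (s : ℝ) (m : ℕ) :
    |qpochInf (-(s * q ^ m)) q| ≤ Real.exp (|s| * (1 - q)⁻¹) := by
  refine le_of_tendsto (qinf_tendsto hq0 hq1 _).abs (Eventually.of_forall fun n => ?_)
  unfold qpoch
  rw [Finset.abs_prod]
  calc ∏ i ∈ Finset.range n, |1 - -(s * q ^ m) * q ^ i|
      ≤ ∏ i ∈ Finset.range n, Real.exp (|s| * q ^ i) := by
        refine Finset.prod_le_prod (fun i _ => abs_nonneg _) fun i _ => ?_
        have h1 : q ^ m ≤ 1 := pow_le_one₀ hq0.le hq1.le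
        have h2 : 0 < q ^ i := pow_pos hq0 i
        have h3 : 0 < q ^ m := pow_pos hq0 m
        have h4 : |1 - -(s * q ^ m) * q ^ i| ≤ 1 + |s| * q ^ m * q ^ i := by
          rw [show 1 - -(s * q ^ m) * q ^ i = 1 + s * q ^ m * q ^ i by ring]
          refine (abs_add_le _ _).trans ?_
          rw [abs_one, abs_mul, abs_mul, abs_of_pos h2, abs_of_pos h3]
        have h5 : |s| * q ^ m * q ^ i ≤ |s| * q ^ i := by
          have := mul_le_of_le_one_right (abs_nonneg s) h1
          exact mul_le_mul_of_nonneg_right this h2.le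
        have := Real.add_one_le_exp (|s| * q ^ i)
        linarith
    _ = Real.exp (|s| * ∑ i ∈ Finset.range n, q ^ i) := by
        rw [← Real.exp_sum, Finset.mul_sum]
    _ ≤ _ := by
        refine Real.exp_le_exp.2 (mul_le_mul_of_nonneg_left ?_ (abs_nonneg s))
        have hh := Summable.sum_le_tsum (Finset.range n) (fun i _ => (pow_pos hq0 i).le)
          (summable_geometric_of_lt_one hq0.le hq1)
        rwa [tsum_geometric_of_lt_one hq0.le hq1] at hh

lemma tri_succ (n : ℕ) : (n + 1) * (n + 1 - 1) / 2 = n * (n - 1) / 2 + n := Nat.triangle_succ n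

lemma tri_two (n : ℕ) : n * (n - 1) = n * (n - 1) / 2 + n * (n - 1) / 2 := by
  have := Nat.div_mul_cancel (Nat.even_mul_pred_self n).two_dvd
  omega

lemma tri_add (n k : ℕ) : n * (n - 1) + k * (k - 1) / 2 + n * k
    = (n + k) * (n + k - 1) / 2 + n * (n - 1) / 2 := by
  induction k with
  | zero => have := tri_two n; simpa using this
  | succ k ih =>
    have h1 := tri_succ k
    have h2 := tri_succ (n + k)
    rw [← add_assoc n k 1, h1, h2, mul_add]
    omega

/-- Euler sum. -/
lemma euler_summable (hq0 : 0 < q) (hq1 : q < 1) (z : ℝ) (hz : |z| < 1) :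
    Summable (fun n : ℕ => z ^ n / qpoch q q n) := by
  refine ratio_summable _ (fun n => z / (1 - q * q ^ n)) z hz ?_ ?_
  · have := (tendsto_const_nhds (x := z)).div
      ((tendsto_const_nhds (x := (1:ℝ))).sub ((qtend hq0 hq1).const_mul q)) (by norm_num)
    simpa [Pi.div_def] using this
  · intro n
    rw [qp_succ, pow_succ, div_mul_div_comm]
    congr 1 <;> ring

lemma euler_step (hq0 : 0 < q) (hq1 : q < 1) (z : ℝ) (hz : |z| < 1) :
    (1 - z) * ∑' n : ℕ, z ^ n / qpoch q q n = ∑' n : ℕ, (z * q) ^ n / qpoch q q n := by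
  have hS := euler_summable hq0 hq1 z hz
  have hzq : |z * q| < 1 := by
    rw [abs_mul, abs_of_pos hq0]
    nlinarith [abs_nonneg z]
  have hSq := euler_summable hq0 hq1 (z * q) hzq
  have h1 : ∑' n : ℕ, (z ^ n / qpoch q q n - (z * q) ^ n / qpoch q q n)
      = z * ∑' n : ℕ, z ^ n / qpoch q q n := by
    rw [(hS.sub hSq).tsum_eq_zero_add, ← tsum_mul_left]
    simp only [pow_zero, sub_self, zero_add]
    refine tsum_congr fun n => ?_
    have h2 := (qp_pos hq0 hq1 q hq1 n).ne'
    have h3 := (qp_pos hq0 hq1 q hq1 (n + 1)).ne'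
    rw [qp_succ] at h3 ⊢
    have h4 := right_ne_zero_of_mul h3
    field_simp
    ring
  rw [hS.tsum_sub hSq] at h1
  linarith

lemma euler (hq0 : 0 < q) (hq1 : q < 1) (z : ℝ) (hz : |z| < 1) :
    qpochInf z q * ∑' n : ℕ, z ^ n / qpoch q q n = 1 := by
  have hit : ∀ N : ℕ, |z * q ^ N| < 1 := fun N => by
    rw [abs_mul, abs_of_pos (pow_pos hq0 N)]
    have : q ^ N ≤ 1 := pow_le_one₀ hq0.le hq1.le
    nlinarith [abs_nonneg z, pow_pos hq0 N]
  have h1 : ∀ N : ℕ, qpoch z q N * ∑' n : ℕ, z ^ n / qpoch q q n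
      = ∑' n : ℕ, (z * q ^ N) ^ n / qpoch q q n := by
    intro N
    induction N with
    | zero => simp [qp_zero]
    | succ N ih =>
      rw [qp_succ, mul_right_comm, ih, mul_comm, euler_step hq0 hq1 _ (hit N)]
      simp only [pow_succ, mul_assoc]
  have h2 : Tendsto (fun N : ℕ => ∑' n : ℕ, (z * q ^ N) ^ n / qpoch q q n) atTop
      (𝓝 (∑' n : ℕ, (0:ℝ) ^ n / qpoch q q n)) := by
    refine tendsto_tsum_of_dominated_convergence (euler_summable hq0 hq1 z hz).abs ?_ ?_
    · intro n
      have := (((qtend hq0 hq1).const_mul z).pow n).div_const (qpoch q q n)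
      simpa using this
    · refine Eventually.of_forall fun N n => ?_
      have hp := qp_pos hq0 hq1 q hq1 n
      rw [Real.norm_eq_abs, abs_div, abs_div, abs_pow, abs_pow, abs_mul, abs_of_pos (pow_pos hq0 N)]
      have : q ^ N ≤ 1 := pow_le_one₀ hq0.le hq1.le
      have h3 := mul_le_of_le_one_right (abs_nonneg z) this
      have := pow_pos hq0 N
      gcongr
  have h3 : ∑' n : ℕ, (0:ℝ) ^ n / qpoch q q n = 1 := by
    rw [tsum_eq_single 0 (fun n hn => by simp [hn])]
    simp [qp_zero]
  rw [h3] at h2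
  exact tendsto_nhds_unique (((qinf_tendsto hq0 hq1 z).mul_const _).congr h1) h2

/-- finite q-binomial theorem -/
lemma qbinom (hq0 : 0 < q) (hq1 : q < 1) (t : ℝ) (m : ℕ) :
    ∑ p ∈ Finset.HasAntidiagonal.antidiagonal m, (-t) ^ p.1 * q ^ (p.1 * (p.1 - 1) / 2) /
      (qpoch q q p.1 * qpoch q q p.2) = qpoch t q m / qpoch q q m := by
  induction m with
  | zero => simp [qp_zero]
  | succ m ih =>
    have hp := fun n => (qp_pos hq0 hq1 q hq1 n).ne'
    have hf : ∀ n, 1 - q * q ^ n ≠ 0 := fun n => by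
      have := hp (n + 1)
      rw [qp_succ] at this
      exact right_ne_zero_of_mul this
    have key : (1 - q * q ^ m) * ∑ p ∈ Finset.HasAntidiagonal.antidiagonal (m + 1),
        (-t) ^ p.1 * q ^ (p.1 * (p.1 - 1) / 2) / (qpoch q q p.1 * qpoch q q p.2)
        = (1 - t * q ^ m) * ∑ p ∈ Finset.HasAntidiagonal.antidiagonal m,
        (-t) ^ p.1 * q ^ (p.1 * (p.1 - 1) / 2) / (qpoch q q p.1 * qpoch q q p.2) := by
      have e1 : (1 - q * q ^ m) * ∑ p ∈ Finset.HasAntidiagonal.antidiagonal (m + 1),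
        (-t) ^ p.1 * q ^ (p.1 * (p.1 - 1) / 2) / (qpoch q q p.1 * qpoch q q p.2)
        = ∑ p ∈ Finset.HasAntidiagonal.antidiagonal (m + 1), (1 - q ^ p.2) *
          ((-t) ^ p.1 * q ^ (p.1 * (p.1 - 1) / 2) / (qpoch q q p.1 * qpoch q q p.2))
        + ∑ p ∈ Finset.HasAntidiagonal.antidiagonal (m + 1), q ^ p.2 * (1 - q ^ p.1) *
          ((-t) ^ p.1 * q ^ (p.1 * (p.1 - 1) / 2) / (qpoch q q p.1 * qpoch q q p.2)) := by
        rw [Finset.mul_sum, ← Finset.sum_add_distrib]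
        refine Finset.sum_congr rfl fun p hp => ?_
        rw [Finset.HasAntidiagonal.mem_antidiagonal] at hp
        rw [← pow_succ', ← hp, pow_add]
        ring
      rw [e1, Finset.Nat.sum_antidiagonal_succ', Finset.Nat.sum_antidiagonal_succ]
      simp only [pow_zero, sub_self, zero_mul, mul_zero, zero_add, add_zero]
      rw [Finset.mul_sum, ← Finset.sum_add_distrib]
      refine Finset.sum_congr rfl fun p hpm => ?_
      rw [Finset.HasAntidiagonal.mem_antidiagonal] at hpm
      rw [tri_succ, qp_succ, qp_succ, ← hpm]
      have := hp p.1
      have := hp p.2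
      have := hf p.1
      have := hf p.2
      simp only [pow_succ', pow_add]
      field_simp
      ring
    rw [ih] at key
    rw [qp_succ, qp_succ]
    have := hf m
    have := hp m
    rw [eq_div_iff (by positivity)]
    calc _ = qpoch q q m * ((1 - q * q ^ m) * ∑ p ∈ Finset.HasAntidiagonal.antidiagonal (m + 1),
        (-t) ^ p.1 * q ^ (p.1 * (p.1 - 1) / 2) / (qpoch q q p.1 * qpoch q q p.2)) := by ring
      _ = _ := by rw [key]; field_simp

/-- finite identity -/
lemma finite_id (hq0 : 0 < q) (hq1 : q < 1) (t : ℝ) (N : ℕ) : ∀ s : ℝ,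
    ∑ p ∈ Finset.HasAntidiagonal.antidiagonal N, t ^ p.1 / qpoch q q p.1 *
      (qpochInf (-(s * q ^ p.2)) q * s ^ p.2 * q ^ (p.2 * (p.2 - 1) / 2) *
        (qpoch t q p.2 / qpoch q q p.2)) =
    (∏ i ∈ Finset.range N, (t + s * q ^ i)) * qpochInf (-(s * q ^ N)) q / qpoch q q N := by
  induction N with
  | zero => intro s; simp [qp_zero]
  | succ N ih =>
    intro s
    have hp := fun n => (qp_pos hq0 hq1 q hq1 n).ne'
    have hf : ∀ n, 1 - q * q ^ n ≠ 0 := fun n => by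
      have := hp (n + 1)
      rw [qp_succ] at this
      exact right_ne_zero_of_mul this
    have ihs := ih (s * q)
    have key : (1 - q * q ^ N) * ∑ p ∈ Finset.HasAntidiagonal.antidiagonal (N + 1), t ^ p.1 / qpoch q q p.1 *
      (qpochInf (-(s * q ^ p.2)) q * s ^ p.2 * q ^ (p.2 * (p.2 - 1) / 2) *
        (qpoch t q p.2 / qpoch q q p.2)) = (t + s) *
        ∑ p ∈ Finset.HasAntidiagonal.antidiagonal N, t ^ p.1 / qpoch q q p.1 *
      (qpochInf (-((s * q) * q ^ p.2)) q * (s * q) ^ p.2 * q ^ (p.2 * (p.2 - 1) / 2) *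
        (qpoch t q p.2 / qpoch q q p.2)) := by
      have e1 : (1 - q * q ^ N) * ∑ p ∈ Finset.HasAntidiagonal.antidiagonal (N + 1), t ^ p.1 / qpoch q q p.1 *
      (qpochInf (-(s * q ^ p.2)) q * s ^ p.2 * q ^ (p.2 * (p.2 - 1) / 2) *
        (qpoch t q p.2 / qpoch q q p.2))
        = ∑ p ∈ Finset.HasAntidiagonal.antidiagonal (N + 1), q ^ p.2 * (1 - q ^ p.1) * (t ^ p.1 / qpoch q q p.1 *
      (qpochInf (-(s * q ^ p.2)) q * s ^ p.2 * q ^ (p.2 * (p.2 - 1) / 2) *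
        (qpoch t q p.2 / qpoch q q p.2)))
        + ∑ p ∈ Finset.HasAntidiagonal.antidiagonal (N + 1), (1 - q ^ p.2) * (t ^ p.1 / qpoch q q p.1 *
      (qpochInf (-(s * q ^ p.2)) q * s ^ p.2 * q ^ (p.2 * (p.2 - 1) / 2) *
        (qpoch t q p.2 / qpoch q q p.2))) := by
        rw [Finset.mul_sum, ← Finset.sum_add_distrib]
        refine Finset.sum_congr rfl fun p hp => ?_
        rw [Finset.HasAntidiagonal.mem_antidiagonal] at hp
        rw [← pow_succ', ← hp, pow_add]
        ring
      rw [e1, Finset.Nat.sum_antidiagonal_succ, Finset.Nat.sum_antidiagonal_succ']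
      simp only [pow_zero, sub_self, zero_mul, mul_zero, zero_add, add_zero]
      rw [Finset.mul_sum, ← Finset.sum_add_distrib]
      refine Finset.sum_congr rfl fun p hpm => ?_
      have hi := qinf_split hq0 hq1 (-(s * q ^ p.2)) 1
      rw [qp_succ, qp_zero, show -(s * q ^ p.2) * q ^ 1 = -(s * q * q ^ p.2) by ring] at hi
      rw [tri_succ, qp_succ, qp_succ, qp_succ, hi,
        show -(s * q ^ (p.2 + 1)) = -(s * q * q ^ p.2) by ring]
      have := hp p.1
      have := hp p.2
      have := hf p.1
      have := hf p.2
      simp only [pow_succ', pow_add, mul_pow, pow_zero] at *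
      generalize qpochInf (-(s * q * q ^ p.2)) q = Y at *
      generalize q ^ p.2 = X at *
      generalize 1 - q * X = D at *
      field_simp
      ring
    rw [ihs] at key
    rw [Finset.prod_range_succ', qp_succ, eq_div_iff (mul_ne_zero (hp N) (hf N))]
    rw [show -(s * q ^ (N + 1)) = -(s * q * q ^ N) by ring]
    have e2 : ∏ i ∈ Finset.range N, (t + s * q ^ (i + 1))
      = ∏ i ∈ Finset.range N, (t + s * q * q ^ i) :=
      Finset.prod_congr rfl fun i _ => by ring
    rw [e2, mul_comm (qpoch q q N), ← mul_assoc, mul_comm _ (1 - q * q ^ N), key]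
    have := hp N
    field_simp

end

section
variable {q : ℝ}

/-- double sum term -/
noncomputable def dterm (q a s t : ℝ) (p : ℕ × ℕ) : ℝ :=
  qpochInf (-(s * q ^ (p.1 + p.2))) q * (a * s) ^ (p.1 + p.2) *
    q ^ ((p.1 + p.2) * (p.1 + p.2 - 1) / 2) *
    ((-t) ^ p.1 * q ^ (p.1 * (p.1 - 1) / 2) / (qpoch q q p.1 * qpoch q q p.2))

lemma theta_summable (hq0 : 0 < q) (hq1 : q < 1) (z : ℝ) :
    Summable (fun n : ℕ => z ^ n * q ^ (n * (n - 1) / 2) / qpoch q q n) := by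
  refine ratio_summable _ (fun n => z * q ^ n / (1 - q * q ^ n)) 0 (by simp) ?_ ?_
  · have := ((qtend hq0 hq1).const_mul z).div
      ((tendsto_const_nhds (x := (1:ℝ))).sub ((qtend hq0 hq1).const_mul q)) (by norm_num)
    simpa [Pi.div_def] using this
  · intro n
    rw [qp_succ, tri_succ, div_mul_div_comm]
    congr 1 <;> ring

lemma dterm_summable (hq0 : 0 < q) (hq1 : q < 1) (a s t : ℝ) : Summable (dterm q a s t) := by
  have h1 := (theta_summable hq0 hq1 (a * s * t)).abs
  have h2 := (theta_summable hq0 hq1 (a * s)).abs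
  have h3 := (h1.mul_of_nonneg h2 (fun _ => abs_nonneg _) (fun _ => abs_nonneg _)).mul_left
    (Real.exp (|s| * (1 - q)⁻¹))
  refine Summable.of_norm_bounded h3 fun p => ?_
  obtain ⟨n, k⟩ := p
  have e : dterm q a s t (n, k) = qpochInf (-(s * q ^ (n + k))) q *
      ((a * s * t) ^ n * q ^ (n * (n - 1) / 2) / qpoch q q n *
      ((a * s) ^ k * q ^ (k * (k - 1) / 2) / qpoch q q k) *
      ((-1) ^ n * q ^ (n * (n - 1) / 2 + n * k))) := by
    have h := tri_add n k
    have h' := tri_two n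
    have h5 : (n + k) * (n + k - 1) / 2 = n * (n - 1) / 2 + k * (k - 1) / 2 + n * k := by omega
    simp only [dterm]
    rw [h5, neg_pow t]
    simp only [pow_add, mul_pow]
    field_simp
  rw [e, norm_mul, norm_mul, norm_mul, norm_mul, norm_pow, norm_neg, norm_one, one_pow, one_mul]
  simp only [Real.norm_eq_abs]
  refine mul_le_mul (qinf_bound hq0 hq1 s _) ?_ (by positivity) (Real.exp_pos _).le
  refine mul_le_of_le_one_right (by positivity) ?_
  rw [abs_of_pos (pow_pos hq0 _)]
  exact pow_le_one₀ hq0.le hq1.le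

/-- collapsed term -/
noncomputable def bterm (q s t : ℝ) (m : ℕ) : ℝ :=
  qpochInf (-(s * q ^ m)) q * s ^ m * q ^ (m * (m - 1) / 2) * (qpoch t q m / qpoch q q m)

lemma dterm_sum (hq0 : 0 < q) (hq1 : q < 1) (a s t : ℝ) (m : ℕ) :
    ∑ p ∈ Finset.HasAntidiagonal.antidiagonal m, dterm q a s t p = a ^ m * bterm q s t m := by
  rw [bterm, ← qbinom hq0 hq1, Finset.mul_sum, Finset.mul_sum]
  refine Finset.sum_congr rfl fun p hp => ?_
  rw [Finset.HasAntidiagonal.mem_antidiagonal] at hp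
  rw [dterm, hp]
  ring

lemma bterm_summable (hq0 : 0 < q) (hq1 : q < 1) (a s t : ℝ) :
    Summable (fun m => a ^ m * bterm q s t m) ∧
    ∑' p, dterm q a s t p = ∑' m, a ^ m * bterm q s t m := by
  have hS := dterm_summable hq0 hq1 a s t
  have hE := Finset.HasAntidiagonal.sigmaAntidiagonalEquivProd (A := ℕ) |>.summable_iff.2 hS
  have hs := hE.sigma
  have ht := hE.tsum_sigma
  rw [← (Finset.HasAntidiagonal.sigmaAntidiagonalEquivProd (A := ℕ)).tsum_eq (dterm q a s t)]
  have key : ∀ m : ℕ, ∑' c : Finset.HasAntidiagonal.antidiagonal m,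
      (dterm q a s t ∘ Finset.HasAntidiagonal.sigmaAntidiagonalEquivProd) ⟨m, c⟩
      = a ^ m * bterm q s t m := by
    intro m
    rw [← dterm_sum hq0 hq1, ← Finset.tsum_subtype]
    rfl
  simp only [key] at hs ht
  exact ⟨hs, ht⟩

end

/-- Addition identity attached to the Al-Salam–Carlitz polynomials. -/
theorem al_salam_carlitz_addition (q a s t : ℝ)
    (hq0 : 0 < q) (hq1 : q < 1) (hs : -1 < s) (ht : |t| < 1) (hat : |a * t| < 1) :
    Summable (fun n : ℕ =>
      |a ^ n * (∏ i ∈ Finset.range n, (t + s * q ^ i)) /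
        (qpoch q q n * qpoch (-s) q n)|) ∧
    (∀ n : ℕ, Summable (fun k : ℕ =>
      |qpoch 0 q k * (-1) ^ k * q ^ (k * (k - 1) / 2) * (-(a * s * q ^ n)) ^ k /
        (qpoch q q k * qpoch (-(s * q ^ n)) q k)|)) ∧
    Summable (fun n : ℕ =>
      |qpochInf (-(s * q ^ n)) q / qpoch q q n * (-(a * s * t)) ^ n *
        q ^ (n * (n - 1)) * qphi11 0 (-(s * q ^ n)) q (-(a * s * q ^ n))|) ∧
    (qpochInf (-s) q / qpochInf t q) *
      (∑' n : ℕ, a ^ n * (∏ i ∈ Finset.range n, (t + s * q ^ i)) /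
        (qpoch q q n * qpoch (-s) q n)) =
    (1 / (qpochInf t q * qpochInf (a * t) q)) *
      ∑' n : ℕ, qpochInf (-(s * q ^ n)) q / qpoch q q n * (-(a * s * t)) ^ n *
        q ^ (n * (n - 1)) * qphi11 0 (-(s * q ^ n)) q (-(a * s * q ^ n)) := by
  have hp := fun n => (qp_pos hq0 hq1 q hq1 n).ne'
  have hsn := fun n => (qp_pos hq0 hq1 (-s) (by linarith) n).ne'
  have hT : ∀ n k : ℕ, qpochInf (-(s * q ^ n)) q / qpoch q q n * (-(a * s * t)) ^ n *
        q ^ (n * (n - 1)) * (qpoch 0 q k * (-1) ^ k * q ^ (k * (k - 1) / 2) *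
        (-(a * s * q ^ n)) ^ k / (qpoch q q k * qpoch (-(s * q ^ n)) q k))
        = dterm q a s t (n, k) := by
    intro n k
    have h1 : -(s * q ^ n) < 1 := by
      have h1 : q ^ n ≤ 1 := pow_le_one₀ hq0.le hq1.le
      have h2 : 0 < q ^ n := pow_pos hq0 n
      nlinarith
    have h2 := (qp_pos hq0 hq1 _ h1 k).ne'
    have h3 : qpoch 0 q k = 1 := by simp [qpoch]
    have h4 := tri_two n
    have h5 : (n + k) * (n + k - 1) / 2 = n * (n - 1) / 2 + k * (k - 1) / 2 + n * k := by
      have := tri_add n k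
      omega
    rw [qinf_split hq0 hq1 (-(s * q ^ n)) k, h3, h4]
    simp only [dterm]
    rw [h5, show -(s * q ^ n) * q ^ k = -(s * q ^ (n + k)) by ring, neg_pow (a * s * t),
      neg_pow (a * s * q ^ n), neg_pow t]
    have h6 : ((-1 : ℝ) ^ k) * (-1) ^ k = 1 := by rw [← mul_pow]; simp
    have := hp n
    have := hp k
    generalize qpochInf (-(s * q ^ (n + k))) q = Y at *
    generalize qpoch (-(s * q ^ n)) q k = Z at *
    simp only [pow_add, mul_pow, ← pow_mul]
    generalize q ^ (n * (n - 1) / 2) = X1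
    generalize q ^ (k * (k - 1) / 2) = X2
    generalize q ^ (n * k) = X3
    generalize (-1 : ℝ) ^ k = e at *
    generalize (-1 : ℝ) ^ n = e2 at *
    generalize a ^ n = a1
    generalize a ^ k = a2
    generalize s ^ n = s1
    generalize s ^ k = s2
    generalize t ^ n = t1
    generalize qpoch q q n = Q1 at *
    generalize qpoch q q k = Q2 at *
    clear hp hsn
    have h8 : Z * Z⁻¹ = 1 := mul_inv_cancel₀ h2
    simp only [div_eq_mul_inv, mul_inv]
    linear_combination (Y * X1 ^ 2 * X2 * X3 * a1 * s1 * t1 * a2 * s2 * e2 * Q1⁻¹ * Q2⁻¹) *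
      (Z * Z⁻¹ * h6 + h8)
  have hB := bterm_summable hq0 hq1 a s t
  have hD := dterm_summable hq0 hq1 a s t
  have hT' : ∀ n : ℕ, qpochInf (-(s * q ^ n)) q / qpoch q q n * (-(a * s * t)) ^ n *
        q ^ (n * (n - 1)) * qphi11 0 (-(s * q ^ n)) q (-(a * s * q ^ n))
        = ∑' k, dterm q a s t (n, k) := by
    intro n
    rw [qphi11, ← tsum_mul_left]
    exact tsum_congr fun k => hT n k
  refine ⟨?_, ?_, ?_, ?_⟩
  · refine Summable.abs (ratio_summable _
      (fun n => a * (t + s * q ^ n) / ((1 - q * q ^ n) * (1 - -s * q ^ n))) (a * t) hat ?_ ?_)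
    · have hq := qtend hq0 hq1
      have := (((hq.const_mul s).const_add t).const_mul a).div
        (((hq.const_mul q).const_sub 1).mul ((hq.const_mul (-s)).const_sub 1)) (by norm_num)
      simpa [Pi.div_def] using this
    · intro n
      rw [qp_succ, qp_succ, Finset.prod_range_succ, div_mul_div_comm]
      congr 1 <;> ring
  · intro n
    refine Summable.abs (ratio_summable _
      (fun k => (a * s * q ^ n) * q ^ k / ((1 - q * q ^ k) * (1 - -(s * q ^ n) * q ^ k))) 0
        (by simp) ?_ ?_)
    · have hq := qtend hq0 hq1
      have := (hq.const_mul (a * s * q ^ n)).div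
        (((hq.const_mul q).const_sub 1).mul ((hq.const_mul (-(s * q ^ n))).const_sub 1))
          (by norm_num)
      simpa [Pi.div_def] using this
    · intro k
      rw [qp_succ, qp_succ, qp_succ, tri_succ, div_mul_div_comm]
      congr 1 <;> ring
  · simp only [hT']
    exact hD.prod.abs
  · simp only [hT']
    rw [← hD.tsum_prod, hB.2]
    have hE := euler hq0 hq1 (a * t) hat
    have hne := left_ne_zero_of_mul_eq_one hE
    have hC := tsum_mul_tsum_eq_tsum_sum_antidiagonal_of_summable_norm
      (euler_summable hq0 hq1 (a * t) hat).norm hB.1.norm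
    have hL : ∀ n : ℕ, ∑ p ∈ Finset.HasAntidiagonal.antidiagonal n,
        (a * t) ^ p.1 / qpoch q q p.1 * (a ^ p.2 * bterm q s t p.2)
        = qpochInf (-s) q * (a ^ n * (∏ i ∈ Finset.range n, (t + s * q ^ i)) /
        (qpoch q q n * qpoch (-s) q n)) := by
      intro n
      have h1 := finite_id hq0 hq1 t n s
      have h2 : ∑ p ∈ Finset.HasAntidiagonal.antidiagonal n,
        (a * t) ^ p.1 / qpoch q q p.1 * (a ^ p.2 * bterm q s t p.2)
        = a ^ n * ∑ p ∈ Finset.HasAntidiagonal.antidiagonal n, t ^ p.1 / qpoch q q p.1 *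
      (qpochInf (-(s * q ^ p.2)) q * s ^ p.2 * q ^ (p.2 * (p.2 - 1) / 2) *
        (qpoch t q p.2 / qpoch q q p.2)) := by
        rw [Finset.mul_sum]
        refine Finset.sum_congr rfl fun p hp => ?_
        rw [Finset.HasAntidiagonal.mem_antidiagonal] at hp
        rw [bterm, ← hp, pow_add, mul_pow]
        ring
      rw [h2, h1, qinf_split hq0 hq1 (-s) n, show -s * q ^ n = -(s * q ^ n) by ring]
      have := hp n
      have := hsn n
      field_simp
    simp only [hL] at hC
    rw [tsum_mul_left] at hC
    rw [div_mul_eq_mul_div, ← hC]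
    have h7 : ∑' n : ℕ, (a * t) ^ n / qpoch q q n = 1 / qpochInf (a * t) q := by
      rw [eq_div_iff hne, mul_comm]; exact hE
    rw [h7, one_div_mul_eq_div, one_div_mul_eq_div, div_div, mul_comm (qpochInf t q)]
end

section
/- Let α > 0 and x, t, s ∈ ℝ, and define Q_n(u;α) = (u^n/n!) · e^u · ₀F₁(-; α+2n+1; -2xu) for n ∈ ℕ. Then the series below converges absolutely and the addition formula for Laguerre-polynomial moments holds: Q_0(t+s;α) = Σ_{n=0}^∞ [n! (α)_n (-4x²)^n / ((α)_{2n} (α+1)_{2n})] · Q_n(t;α) · Q_n(s;α). -/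
/-- The Pochhammer symbol `(a)_n = a(a+1)⋯(a+n-1)`. -/
noncomputable def poch (a : ℝ) (n : ℕ) : ℝ := ∏ i ∈ Finset.range n, (a + i)

/-- The hypergeometric function `₀F₁(-; c; z)`. -/
noncomputable def zeroF1 (c z : ℝ) : ℝ := ∑' n : ℕ, z ^ n / (poch c n * n.factorial)

/-- `Q_n(u;α) = (u^n/n!) e^u ₀F₁(-; α+2n+1; -2xu)`, the functions attached to
the Laguerre polynomials viewed as moments. -/
noncomputable def QLaguerre (α x u : ℝ) (n : ℕ) : ℝ :=
  u ^ n / n.factorial * Real.exp u * zeroF1 (α + 2 * n + 1) (-(2 * x * u))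

lemma poch_succ' (a : ℝ) (n : ℕ) : poch a (n + 1) = poch a n * (a + n) := by
  simp [poch, Finset.prod_range_succ]

lemma poch_zero' (a : ℝ) : poch a 0 = 1 := by simp [poch]

lemma poch_pos' {a : ℝ} (ha : 0 < a) (n : ℕ) : 0 < poch a n :=
  Finset.prod_pos fun i _ => by positivity

lemma one_le_poch {a : ℝ} (ha : 1 ≤ a) (n : ℕ) : 1 ≤ poch a n := by
  induction n with
  | zero => simp [poch]
  | succ n ih =>
    rw [poch_succ']
    have : (1 : ℝ) ≤ a + n := by
      have : (0 : ℝ) ≤ n := by positivity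
      linarith
    nlinarith

lemma poch_add' (a : ℝ) (m n : ℕ) : poch a (m + n) = poch a m * poch (a + m) n := by
  induction n with
  | zero => simp [poch]
  | succ n ih =>
    rw [← add_assoc, poch_succ', poch_succ', ih]
    push_cast
    ring

lemma poch_shift (a : ℝ) (n : ℕ) : poch (a + 1) n * a = poch a n * (a + n) := by
  induction n with
  | zero => simp [poch]
  | succ n ih =>
    rw [poch_succ', poch_succ']
    push_cast
    linear_combination (a + 1 + n) * ih

lemma desc_succ (a n : ℕ) :
    (Nat.descFactorial a (n + 1) : ℝ) = ((a : ℝ) - n) * Nat.descFactorial a n := by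
  rw [Nat.descFactorial_succ]
  rcases le_or_gt n a with h | h
  · push_cast [h]
    ring
  · simp [Nat.descFactorial_of_lt h]

/-- The summand of the terminating very well-poised sum. -/
noncomputable def TT (α : ℝ) (a b n : ℕ) : ℝ :=
  (-1) ^ n * poch α n * (α + 2 * n) / α * Nat.descFactorial a n * Nat.descFactorial b n /
    (n.factorial * poch (α + 1) (a + n) * poch (α + 1) (b + n))

lemma TT_partial (α : ℝ) (hα : 0 < α) (a b N : ℕ) :
    ∑ n ∈ Finset.range (N + 1), ((α + a + b + 1) * TT α (a + 1) b n - TT α a b n) =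
      (α + N) * (b - N) / ((α + 2 * N) * (α + a + N + 1)) * TT α a b N := by
  induction N with
  | zero =>
    have h1 := (poch_pos' (a := α + 1) (by linarith) a).ne'
    have h2 := (poch_pos' (a := α + 1) (by linarith) b).ne'
    have h3 : α + 1 + a ≠ 0 := by positivity
    have h4 : α + a + 1 ≠ 0 := by positivity
    simp [TT, poch_succ', poch_zero']
    field_simp
    ring
  | succ N ih =>
    rw [Finset.sum_range_succ, ih]
    have h1 := (poch_pos' (a := α + 1) (by linarith) (a + N)).ne'
    have h2 := (poch_pos' (a := α + 1) (by linarith) (b + N)).ne'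
    have e1 : a + 1 + (N + 1) = a + N + 1 + 1 := by ring
    have e2 : a + (N + 1) = a + N + 1 := by ring
    have e3 : b + (N + 1) = b + N + 1 := by ring
    have k1 : α + 1 + (a + N) ≠ 0 := by positivity
    have k2 : α + 1 + (a + N + 1) ≠ 0 := by positivity
    have k3 : α + 1 + (b + N) ≠ 0 := by positivity
    have k4 : α + a + N + 1 ≠ 0 := by positivity
    have k5 : α + a + (N + 1) + 1 ≠ 0 := by positivity
    have k6 : α + 2 * N ≠ 0 := by positivity
    have k7 : α + 2 * (N + 1) ≠ 0 := by positivity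
    have k8 : (N.factorial : ℝ) ≠ 0 := by positivity
    have k9 : (N : ℝ) + 1 ≠ 0 := by positivity
    simp only [TT, e1, e2, e3, poch_succ', desc_succ a, desc_succ b,
      Nat.succ_descFactorial_succ, Nat.factorial_succ, pow_succ]
    push_cast
    field_simp
    ring

lemma TT_zero_of_lt (α : ℝ) {a b n : ℕ} (h : a < n ∨ b < n) : TT α a b n = 0 := by
  rcases h with h | h <;> simp [TT, Nat.descFactorial_of_lt h]

lemma TT_sum (α : ℝ) (hα : 0 < α) (a b N : ℕ) (hN : a < N) :
    ∑ n ∈ Finset.range N, TT α a b n = 1 / poch (α + 1) (a + b) := by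
  induction a generalizing N with
  | zero =>
    rw [Finset.sum_eq_single_of_mem 0 (by simpa using hN)
      (fun n _ hn => TT_zero_of_lt α (Or.inl (Nat.pos_of_ne_zero hn)))]
    simp [TT, poch_zero']
    field_simp
  | succ a ih =>
    obtain ⟨M, rfl⟩ : ∃ M, N = M + 1 := ⟨N - 1, by omega⟩
    have h := TT_partial α hα a b M
    rw [TT_zero_of_lt α (Or.inl (show a < M by omega)), Finset.sum_sub_distrib,
      ← Finset.mul_sum, ih _ (by omega)] at h
    have e : a + 1 + b = a + b + 1 := by ring
    have h1 := (poch_pos' (a := α + 1) (by linarith) (a + b)).ne'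
    have k1 : α + 1 + ((a + b : ℕ) : ℝ) ≠ 0 := by positivity
    rw [e, poch_succ', eq_div_iff (by positivity)]
    push_cast
    have h' : (α + a + b + 1) * ∑ n ∈ Finset.range (M + 1), TT α (a + 1) b n
      = 1 / poch (α + 1) (a + b) := by linarith
    rw [eq_div_iff h1] at h'
    linear_combination h'

lemma TT_hasSum (α : ℝ) (hα : 0 < α) (a b : ℕ) :
    HasSum (fun n => TT α a b n) (1 / poch (α + 1) (a + b)) := by
  rw [← TT_sum α hα a b (a + 1) (by omega)]
  exact hasSum_sum_of_ne_finset_zero fun n hn =>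
    TT_zero_of_lt α (Or.inl (by simpa using hn))

/-- summand of the triple series -/
noncomputable def FF (α x t s : ℝ) (p : ℕ × (ℕ × ℕ)) : ℝ :=
  (p.1.factorial : ℝ) * poch α p.1 * (-(4 * x ^ 2)) ^ p.1 /
      (poch α (2 * p.1) * poch (α + 1) (2 * p.1)) *
    (t ^ p.1 / p.1.factorial) * (s ^ p.1 / p.1.factorial) *
    (((-(2 * x * t)) ^ p.2.1 / (poch (α + 2 * p.1 + 1) p.2.1 * p.2.1.factorial)) *
     ((-(2 * x * s)) ^ p.2.2 / (poch (α + 2 * p.1 + 1) p.2.2 * p.2.2.factorial)))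

noncomputable def GG (α x t s : ℝ) (p : ℕ × (ℕ × ℕ)) : ℝ :=
  (-(2 * x * t)) ^ p.2.1 / p.2.1.factorial * ((-(2 * x * s)) ^ p.2.2 / p.2.2.factorial) *
    TT α p.2.1 p.2.2 p.1

def shiftE (p : ℕ × (ℕ × ℕ)) : ℕ × (ℕ × ℕ) := (p.1, p.1 + p.2.1, p.1 + p.2.2)

lemma shiftE_inj : Function.Injective shiftE := by
  rintro ⟨n, i, j⟩ ⟨n', i', j'⟩ h
  simp only [shiftE, Prod.mk.injEq] at h ⊢
  omega

lemma GG_support (α x t s : ℝ) (p : ℕ × (ℕ × ℕ)) (hp : p ∉ Set.range shiftE) :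
    GG α x t s p = 0 := by
  obtain ⟨n, a, b⟩ := p
  have : a < n ∨ b < n := by
    by_contra! h
    exact hp ⟨(n, a - n, b - n), by
      simp only [shiftE]
      rw [Nat.add_sub_cancel' h.1, Nat.add_sub_cancel' h.2]⟩
  simp [GG, TT_zero_of_lt α this]

lemma desc_fact (n i : ℕ) :
    (Nat.descFactorial (n + i) n : ℝ) = (n + i).factorial / i.factorial := by
  rw [eq_div_iff (by positivity)]
  have := Nat.factorial_mul_descFactorial (n := n + i) (k := n) (by omega)
  rw [Nat.add_sub_cancel_left] at this
  rw [mul_comm]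
  exact_mod_cast this

lemma GG_shift (α : ℝ) (hα : 0 < α) (x t s : ℝ) (p : ℕ × (ℕ × ℕ)) :
    GG α x t s (shiftE p) = FF α x t s p := by
  obtain ⟨n, i, j⟩ := p
  have e1 : ∀ i, n + i + n = 2 * n + i := by intro i; ring
  have hs := poch_shift α (2 * n)
  have hs' : poch (α + 1) (2 * n) = poch α (2 * n) * (α + 2 * n) / α := by
    rw [eq_div_iff hα.ne', hs]; push_cast; ring
  have e2 : α + 1 + ((2 * n : ℕ) : ℝ) = α + 2 * n + 1 := by push_cast; ring
  have p1 := (poch_pos' (a := α + 2 * n + 1) (by positivity) i).ne'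
  have p2 := (poch_pos' (a := α + 2 * n + 1) (by positivity) j).ne'
  have p3 := (poch_pos' hα (2 * n)).ne'
  have p4 : α + 2 * n ≠ 0 := by positivity
  have f1 : ((n + i).factorial : ℝ) ≠ 0 := by positivity
  have f2 : ((n + j).factorial : ℝ) ≠ 0 := by positivity
  have f3 : (n.factorial : ℝ) ≠ 0 := by positivity
  have f4 : (i.factorial : ℝ) ≠ 0 := by positivity
  have f5 : (j.factorial : ℝ) ≠ 0 := by positivity
  have q : (-(4 * x ^ 2)) ^ n * t ^ n * s ^ n =
      (-1) ^ n * (-(2 * x * t)) ^ n * (-(2 * x * s)) ^ n := by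
    rw [← mul_pow, ← mul_pow, ← mul_pow, ← mul_pow]; congr 1; ring
  have l : GG α x t s (shiftE (n, i, j)) =
      ((-1) ^ n * (-(2 * x * t)) ^ n * (-(2 * x * s)) ^ n) *
      (poch α n * α * (-(2 * x * t)) ^ i * (-(2 * x * s)) ^ j /
      (poch α (2 * n) ^ 2 * (α + 2 * n) * poch (α + 2 * n + 1) i * poch (α + 2 * n + 1) j *
        n.factorial * i.factorial * j.factorial)) := by
    simp only [GG, shiftE, TT, e1, poch_add' (α + 1) (2 * n), e2, desc_fact, hs', pow_add]
    field_simp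
  rw [l, ← q]
  simp only [FF, hs']
  generalize (-(2 * x * t)) ^ i = A
  generalize (-(2 * x * s)) ^ j = B
  generalize (-(4 * x ^ 2)) ^ n = C
  field_simp

lemma poch_le_two (α : ℝ) (hα : 0 < α) (n : ℕ) : poch α n ≤ poch α (2 * n) := by
  rw [two_mul, poch_add']
  rcases Nat.eq_zero_or_pos n with rfl | h
  · simp [poch]
  · have h1 : (1 : ℝ) ≤ n := by exact_mod_cast h
    exact le_mul_of_one_le_right (poch_pos' hα n).le (one_le_poch (by linarith) n)

lemma FF_summable_abs (α : ℝ) (hα : 0 < α) (x t s : ℝ) :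
    Summable (fun p => |FF α x t s p|) := by
  have hs := (Real.summable_pow_div_factorial (4 * x ^ 2 * |t| * |s|)).mul_of_nonneg
    ((Real.summable_pow_div_factorial (|2 * x * t|)).mul_of_nonneg
      (Real.summable_pow_div_factorial (|2 * x * s|))
      (fun _ => by positivity) (fun _ => by positivity))
      (fun _ => by positivity) (fun _ => by simp only [Pi.zero_apply]; positivity)
  refine Summable.of_nonneg_of_le (fun _ => abs_nonneg _) ?_ hs
  rintro ⟨n, i, j⟩
  have hb : ∀ (z : ℝ) (i : ℕ), |z ^ i / (poch (α + 2 * n + 1) i * i.factorial)| ≤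
      |z| ^ i / i.factorial := by
    intro z i
    have h1 : 1 ≤ poch (α + 2 * n + 1) i :=
      one_le_poch (by have : (0:ℝ) ≤ n := by positivity
                      linarith) i
    have h0 : (0 : ℝ) < i.factorial := by positivity
    rw [abs_div, abs_pow, abs_of_pos (a := poch _ _ * _) (by positivity)]
    exact div_le_div_of_nonneg_left (by positivity) h0 (by nlinarith)
  have hc : |(n.factorial : ℝ) * poch α n * (-(4 * x ^ 2)) ^ n /
      (poch α (2 * n) * poch (α + 1) (2 * n)) *
    (t ^ n / n.factorial) * (s ^ n / n.factorial)| ≤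
      (4 * x ^ 2 * |t| * |s|) ^ n / n.factorial := by
    have p0 := poch_pos' hα n
    have p1 := poch_pos' hα (2 * n)
    have p2 := one_le_poch (a := α + 1) (by linarith) (2 * n)
    have p3 := poch_le_two α hα n
    have e : (n.factorial : ℝ) * poch α n * (-(4 * x ^ 2)) ^ n /
      (poch α (2 * n) * poch (α + 1) (2 * n)) *
      (t ^ n / n.factorial) * (s ^ n / n.factorial) =
      (poch α n / (poch α (2 * n) * poch (α + 1) (2 * n))) *
        ((-(4 * x ^ 2) * t * s) ^ n / n.factorial) := by
      rw [mul_pow, mul_pow]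
      generalize (-(4 * x ^ 2)) ^ n = C
      field_simp
    rw [e, abs_mul, abs_div, abs_div, abs_pow, abs_mul (_ * _) s, abs_mul _ t, abs_neg, abs_of_pos p0,
      abs_of_pos (a := poch _ _ * _) (by positivity), abs_of_nonneg (a := 4 * x ^ 2) (by positivity),
      Nat.abs_cast]
    refine mul_le_of_le_one_left (by positivity) ?_
    rw [div_le_one (by positivity)]
    nlinarith
  simp only [FF]
  rw [abs_mul]
  refine mul_le_mul hc ?_ (abs_nonneg _) (by positivity)
  rw [abs_mul, ← abs_neg (2 * x * t), ← abs_neg (2 * x * s)]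
  exact mul_le_mul (hb _ _) (hb _ _) (abs_nonneg _) (by positivity)

lemma zeroF1_summable (c z : ℝ) (hc : 1 ≤ c) :
    Summable (fun n : ℕ => |z ^ n / (poch c n * n.factorial)|) := by
  refine Summable.of_nonneg_of_le (fun _ => abs_nonneg _) ?_
    (Real.summable_pow_div_factorial |z|)
  intro i
  have h1 : 1 ≤ poch c i := one_le_poch hc i
  have h0 : (0 : ℝ) < i.factorial := by positivity
  rw [abs_div, abs_pow, abs_of_pos (a := poch _ _ * _) (by positivity)]
  exact div_le_div_of_nonneg_left (by positivity) h0 (by nlinarith)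

lemma hasSum_prod_aux (C : ℝ) (f g : ℕ → ℝ) (hf : Summable fun n => |f n|)
    (hg : Summable fun n => |g n|) :
    HasSum (fun q : ℕ × ℕ => C * (f q.1 * g q.2)) (C * ((∑' n, f n) * ∑' n, g n)) := by
  have h12 : Summable (fun q : ℕ × ℕ => f q.1 * g q.2) :=
    summable_mul_of_summable_norm (R := ℝ) hf hg
  exact (hf.of_abs.hasSum.mul hg.of_abs.hasSum h12).mul_left C

lemma FF_inner (α : ℝ) (hα : 0 < α) (x t s : ℝ) (n : ℕ) :
    HasSum (fun q => FF α x t s (n, q))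
      ((n.factorial : ℝ) * poch α n * (-(4 * x ^ 2)) ^ n /
          (poch α (2 * n) * poch (α + 1) (2 * n)) *
        (t ^ n / n.factorial) * (s ^ n / n.factorial) *
        (zeroF1 (α + 2 * n + 1) (-(2 * x * t)) * zeroF1 (α + 2 * n + 1) (-(2 * x * s)))) := by
  have hc : (1 : ℝ) ≤ α + 2 * n + 1 := by
    have : (0:ℝ) ≤ n := by positivity
    linarith
  have h1 := zeroF1_summable _ (-(2 * x * t)) hc
  have h2 := zeroF1_summable _ (-(2 * x * s)) hc
  exact hasSum_prod_aux _ _ _ h1 h2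

lemma GG_hasSum (α : ℝ) (hα : 0 < α) (x t s : ℝ) :
    HasSum (GG α x t s) (zeroF1 (α + 1) (-(2 * x * (t + s)))) := by
  have hF := (FF_summable_abs α hα x t s).of_abs
  have hG : Summable (GG α x t s) := by
    rw [← shiftE_inj.summable_iff (GG_support α x t s)]
    exact hF.congr fun p => (GG_shift α hα x t s p).symm
  have hab := ((Equiv.prodComm (ℕ × ℕ) ℕ).hasSum_iff.mpr hG.hasSum).prod_fiberwise
    (g := fun q : ℕ × ℕ => (-(2 * x * t)) ^ q.1 / q.1.factorial *
      ((-(2 * x * s)) ^ q.2 / q.2.factorial) * (1 / poch (α + 1) (q.1 + q.2)))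
    (fun q => (TT_hasSum α hα q.1 q.2).mul_left _)
  have hN := ((Finset.HasAntidiagonal.sigmaAntidiagonalEquivProd (A := ℕ)).hasSum_iff.mpr hab).sigma
    (fun n => hasSum_fintype _)
  have : zeroF1 (α + 1) (-(2 * x * (t + s))) = ∑' p, GG α x t s p := by
    rw [← hN.tsum_eq, zeroF1]
    congr 1
    ext n
    rw [Finset.univ_eq_attach]
    simp only [Function.comp, Finset.HasAntidiagonal.sigmaAntidiagonalEquivProd_apply]
    rw [Finset.sum_attach (Finset.HasAntidiagonal.antidiagonal n) (fun q => (-(2 * x * t)) ^ q.1 / q.1.factorial *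
      ((-(2 * x * s)) ^ q.2 / q.2.factorial) * (1 / poch (α + 1) (q.1 + q.2)))]
    have e : -(2 * x * (t + s)) = -(2 * x * t) + -(2 * x * s) := by ring
    rw [e, Commute.add_pow' (Commute.all _ _), Finset.sum_div]
    refine Finset.sum_congr rfl fun q hq => ?_
    obtain ⟨a, b⟩ := q
    rw [Finset.HasAntidiagonal.mem_antidiagonal] at hq
    subst hq
    simp only [nsmul_eq_mul]
    rw [Nat.cast_add_choose]
    have := (poch_pos' (a := α + 1) (by linarith) (a + b)).ne'
    field_simp
  rw [this]
  exact hG.hasSum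

/-- Addition formula for the Laguerre-polynomial moment functions. -/
theorem laguerre_moment_addition (α : ℝ) (hα : 0 < α) (x t s : ℝ) :
    Summable (fun n : ℕ =>
      |(n.factorial : ℝ) * poch α n * (-(4 * x ^ 2)) ^ n /
          (poch α (2 * n) * poch (α + 1) (2 * n)) *
        QLaguerre α x t n * QLaguerre α x s n|) ∧
    QLaguerre α x (t + s) 0 =
      ∑' n : ℕ, (n.factorial : ℝ) * poch α n * (-(4 * x ^ 2)) ^ n /
          (poch α (2 * n) * poch (α + 1) (2 * n)) *
        QLaguerre α x t n * QLaguerre α x s n := by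
  have hF := FF_summable_abs α hα x t s
  have hFs : HasSum (FF α x t s) (zeroF1 (α + 1) (-(2 * x * (t + s)))) := by
    have := (shiftE_inj.hasSum_iff (GG_support α x t s)).mpr (GG_hasSum α hα x t s)
    convert this using 1
    ext p
    exact (GG_shift α hα x t s p).symm
  have hterm : ∀ n : ℕ, (n.factorial : ℝ) * poch α n * (-(4 * x ^ 2)) ^ n /
          (poch α (2 * n) * poch (α + 1) (2 * n)) *
        QLaguerre α x t n * QLaguerre α x s n = Real.exp (t + s) *
      ((n.factorial : ℝ) * poch α n * (-(4 * x ^ 2)) ^ n /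
          (poch α (2 * n) * poch (α + 1) (2 * n)) *
        (t ^ n / n.factorial) * (s ^ n / n.factorial) *
        (zeroF1 (α + 2 * n + 1) (-(2 * x * t)) * zeroF1 (α + 2 * n + 1) (-(2 * x * s)))) := by
    intro n
    rw [Real.exp_add]
    simp only [QLaguerre]
    ring
  have hsum := (hFs.prod_fiberwise (FF_inner α hα x t s)).mul_left (Real.exp (t + s))
  simp only [hterm]
  refine ⟨hsum.summable.abs, ?_⟩
  rw [hsum.tsum_eq]
  simp [QLaguerre]
end
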